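/- arXiv:1410.6111 — 2 statements merged into one kernel-verified Lean document; each statement's English description precedes it below -/
import Mathlib

section
/- Let X be a finite poset, D ⊆ X an antichain, and n ≥ 0. Define φ_n : C^f_n(X, X∖D) → ⊕_{x∈D} C^f_n(C_x, Ĉ_x) on the class of an n-chain s of X by: the x-component of φ_n(s̄) is the class of s in C^f_n(C_x, Ĉ_x) if x ∈ s, and 0 otherwise. For x ∈ D define i^x_n : C^f_n(C_x, Ĉ_x) → C^f_n(X, X∖D) on the class of an n-chain s of C_x by i^x_n(s̄) = s̄. Then φ_n is a group isomorphism whose inverse sends (σ_x)_{x∈D} to Σ_{x∈D} i^x_n(σ_x); moreover these isomorphisms commute with the differentials, so the chain complexes C^f(X, X∖D) and ⊕_{x∈D} C^f(C_x, Ĉ_x) are isomorphic. -/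
open scoped Classical

universe u

section ChainComplexes

variable (α : Type u) [PartialOrder α]

/-- The chains of the subposet `S` of `α` (encoded as finsets of `α` contained in `S` that are
totally ordered) having cardinality `n + 1`.  For `n = -1` this contains only the empty chain.
This is the canonical basis of the degree-`n` part of the reduced f-chain complex of `S`. -/
def RChains (S : Set α) (n : ℤ) : Type u :=
  {s : Finset α // (↑s : Set α) ⊆ S ∧ IsChain (· ≤ ·) (↑s : Set α) ∧ (s.card : ℤ) = n + 1}

/-- The degree-`n` part of the reduced f-chain complex of the subposet `S`:
the free abelian group on the chains of `S` of cardinality `n + 1`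
(including the empty chain in degree `-1`). -/
abbrev RCgrp (S : Set α) (n : ℤ) : Type u := RChains α S n →₀ ℤ

/-- The sign `sgn_s(v)`: `(-1) ^ k` where `v` is the `(k+1)`-st smallest element of `s`. -/
noncomputable def chainSgn (s : Finset α) (v : α) : ℤ :=
  (-1) ^ (s.filter fun a => a < v).card

theorem erase_spec {S : Set α} {n : ℤ} {s : Finset α} (hsub : (↑s : Set α) ⊆ S)
    (hch : IsChain (· ≤ ·) (↑s : Set α)) (hcard : (s.card : ℤ) = n + 1) {v : α} (hv : v ∈ s) :
    (↑(s.erase v) : Set α) ⊆ S ∧ IsChain (· ≤ ·) (↑(s.erase v) : Set α) ∧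
      ((s.erase v).card : ℤ) = (n - 1) + 1 := by
  refine ⟨fun x hx => hsub (Finset.coe_subset.mpr (Finset.erase_subset _ _) hx),
    IsChain.mono (Finset.coe_subset.mpr (Finset.erase_subset _ _)) hch, ?_⟩
  rw [Finset.cast_card_erase_of_mem hv, hcard]; ring

/-- The differential of the reduced f-chain complex of the subposet `S`. -/
noncomputable def rd (S : Set α) (n : ℤ) : RCgrp α S n →+ RCgrp α S (n - 1) :=
  ((Finsupp.lift (RCgrp α S (n - 1)) ℤ (RChains α S n)) (fun s =>
    ∑ v ∈ s.1.attach,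
      chainSgn α s.1 v.1 •
        Finsupp.single
          (⟨s.1.erase v.1, erase_spec α s.2.1 s.2.2.1 s.2.2.2 v.2⟩ : RChains α S (n - 1))
          (1 : ℤ))).toAddMonoidHom

/-- The chains of the subposet `S` of cardinality `n + 1` that are not contained in `A`:
the canonical basis of the degree-`n` part of the relative f-chain complex
`C^f(S, A) = C^f(S)/C^f(A)`. -/
def FChains (S A : Set α) (n : ℤ) : Type u :=
  {s : Finset α // (↑s : Set α) ⊆ S ∧ IsChain (· ≤ ·) (↑s : Set α) ∧ (s.card : ℤ) = n + 1 ∧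
      ¬(↑s : Set α) ⊆ A}

/-- The degree-`n` part of the relative f-chain complex `C^f(S, A) = C^f(S)/C^f(A)`,
realized as the free abelian group on the chains of `S` not contained in `A`. -/
abbrev FCgrp (S A : Set α) (n : ℤ) : Type u := FChains α S A n →₀ ℤ

/-- The differential of the relative f-chain complex `C^f(S, A)`. -/
noncomputable def fd (S A : Set α) (n : ℤ) : FCgrp α S A n →+ FCgrp α S A (n - 1) :=
  ((Finsupp.lift (FCgrp α S A (n - 1)) ℤ (FChains α S A n)) (fun s =>
    ∑ v ∈ s.1.attach,
      chainSgn α s.1 v.1 •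
        (if h : ¬(↑(s.1.erase v.1) : Set α) ⊆ A then
          Finsupp.single
            (⟨s.1.erase v.1,
              ⟨(erase_spec α s.2.1 s.2.2.1 s.2.2.2.1 v.2).1,
                (erase_spec α s.2.1 s.2.2.1 s.2.2.2.1 v.2).2.1,
                (erase_spec α s.2.1 s.2.2.1 s.2.2.2.1 v.2).2.2, h⟩⟩ : FChains α S A (n - 1))
            (1 : ℤ)
         else 0))).toAddMonoidHom

end ChainComplexes

section GradedHomology

/-- Transport along an equality of degrees. -/
def castAddEquiv (G : ℤ → Type*) [∀ n, AddCommGroup (G n)] {m n : ℤ} (h : m = n) :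
    G m ≃+ G n := by subst h; exact AddEquiv.refl _

/-- The group of `n`-boundaries of a graded group `G` with degree `-1` maps `d`. -/
noncomputable def boundariesOf (G : ℤ → Type*) [∀ n, AddCommGroup (G n)]
    (d : (n : ℤ) → G n →+ G (n - 1)) (n : ℤ) : AddSubgroup (G n) :=
  AddSubgroup.map (castAddEquiv G (show n + 1 - 1 = n by ring)).toAddMonoidHom (d (n + 1)).range

/-- The `n`-th homology group of a graded abelian group `G` equipped with degree `-1`
homomorphisms `d` (cycles modulo boundaries; when `d ∘ d = 0` this is the usual homology). -/
noncomputable def gradedHomology (G : ℤ → Type*) [∀ n, AddCommGroup (G n)]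
    (d : (n : ℤ) → G n →+ G (n - 1)) (n : ℤ) : Type _ :=
  (d n).ker ⧸ ((boundariesOf G d n).addSubgroupOf (d n).ker)

noncomputable instance (G : ℤ → Type*) [∀ n, AddCommGroup (G n)]
    (d : (n : ℤ) → G n →+ G (n - 1)) (n : ℤ) : AddCommGroup (gradedHomology G d n) :=
  inferInstanceAs (AddCommGroup (_ ⧸ _))

end GradedHomology

section Homology

variable (α : Type u) [PartialOrder α]

/-- The `n`-th reduced f-homology group `H̃^f_n(S)` of the subposet `S`. -/
noncomputable def RH (S : Set α) (n : ℤ) : Type u :=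
  gradedHomology (RCgrp α S) (rd α S) n

noncomputable instance (S : Set α) (n : ℤ) : AddCommGroup (RH α S n) :=
  inferInstanceAs (AddCommGroup (gradedHomology _ _ _))

/-- The `n`-th relative f-homology group `H^f_n(S, A)`. -/
noncomputable def FH (S A : Set α) (n : ℤ) : Type u :=
  gradedHomology (FCgrp α S A) (fd α S A) n

noncomputable instance (S A : Set α) (n : ℤ) : AddCommGroup (FH α S A n) :=
  inferInstanceAs (AddCommGroup (gradedHomology _ _ _))

/-- The `n`-th (unreduced) f-homology group `H^f_n(S)` of the subposet `S`,
i.e. the homology of the complex freely generated by the nonempty chains of `S`. -/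
noncomputable def HF (S : Set α) (n : ℤ) : Type u := FH α S ∅ n

noncomputable instance (S : Set α) (n : ℤ) : AddCommGroup (HF α S n) :=
  inferInstanceAs (AddCommGroup (FH α S ∅ n))

end Homology

/-- The homomorphism `i^x_n : C^f_n(C_x, Ĉ_x) → C^f_n(X, X∖D)` induced by regarding an
`n`-chain of `(C_x, Ĉ_x)` as an `n`-chain of `(X, X∖D)` (for `x ∈ D`). -/
noncomputable def iMap {α : Type u} [PartialOrder α] (D : Set α) (x : D) (n : ℤ) :
    FCgrp α {a | a ≤ (x : α) ∨ (x : α) ≤ a}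
        ({a | a ≤ (x : α) ∨ (x : α) ≤ a} \ {(x : α)}) n →+
      FCgrp α Set.univ Dᶜ n :=
  Finsupp.mapDomain.addMonoidHom (fun s => ⟨s.1, Set.subset_univ _, s.2.2.1, s.2.2.2.1, by
    have hx : (x : α) ∈ s.1 := by
      by_contra hxs
      apply s.2.2.2.2
      intro y hy
      refine ⟨s.2.1 hy, fun hyx => hxs ?_⟩
      rw [Set.mem_singleton_iff] at hyx
      subst hyx
      exact Finset.mem_coe.mp hy
    intro hsub
    exact hsub (Finset.mem_coe.mpr hx) x.2⟩)

theorem aux_mem {α : Type u} [PartialOrder α] {x : α} {n : ℤ}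
    (s : FChains α {a | a ≤ x ∨ x ≤ a} ({a | a ≤ x ∨ x ≤ a} \ {x}) n) : x ∈ s.1 := by
  by_contra hxs
  apply s.2.2.2.2
  intro y hy
  refine ⟨s.2.1 hy, fun hyx => hxs ?_⟩
  rw [Set.mem_singleton_iff] at hyx
  subst hyx
  exact Finset.mem_coe.mp hy

theorem aux_uniq {α : Type u} [PartialOrder α] {D : Set α} (hD : IsAntichain (· ≤ ·) D)
    {s : Finset α} (hs : IsChain (· ≤ ·) (↑s : Set α)) {x y : α} (hx : x ∈ D) (hy : y ∈ D)
    (hxs : x ∈ s) (hys : y ∈ s) : x = y := by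
  by_contra h
  rcases hs (Finset.mem_coe.mpr hxs) (Finset.mem_coe.mpr hys) h with h1 | h1
  · exact hD hx hy h h1
  · exact hD hy hx (Ne.symm h) h1

theorem aux_sub {α : Type u} [PartialOrder α] {S A : Set α} {n : ℤ} {s : FChains α S A n}
    {x : α} (hx : x ∈ s.1) : (↑s.1 : Set α) ⊆ {a | a ≤ x ∨ x ≤ a} := by
  intro y hy
  rcases eq_or_ne y x with h | h
  · exact Or.inl (le_of_eq h)
  · exact s.2.2.1 hy (Finset.mem_coe.mpr hx) h

/-- A chain through `x`, as a chain of `(C_x, Ĉ_x)`. -/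
def toC {α : Type u} [PartialOrder α] {S A : Set α} {n : ℤ} (s : FChains α S A n)
    (x : α) (hx : x ∈ s.1) : FChains α {a | a ≤ x ∨ x ≤ a} ({a | a ≤ x ∨ x ≤ a} \ {x}) n :=
  ⟨s.1, aux_sub hx, s.2.2.1, s.2.2.2.1, fun hsub =>
      (hsub (Finset.mem_coe.mpr hx)).2 rfl⟩

def toX {α : Type u} [PartialOrder α] {D : Set α} {n : ℤ} (x : D)
    (s : FChains α {a | a ≤ (x : α) ∨ (x : α) ≤ a}
        ({a | a ≤ (x : α) ∨ (x : α) ≤ a} \ {(x : α)}) n) : FChains α Set.univ Dᶜ n :=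
  ⟨s.1, Set.subset_univ _, s.2.2.1, s.2.2.2.1, fun hsub =>
        hsub (Finset.mem_coe.mpr (aux_mem s)) x.2⟩

noncomputable def erC {α : Type u} [PartialOrder α] {S A : Set α} {n : ℤ} (s : FChains α S A n)
    (v : α) (hv : v ∈ s.1) (h : ¬(↑(s.1.erase v) : Set α) ⊆ A) : FChains α S A (n - 1) :=
  ⟨s.1.erase v,
              ⟨(erase_spec α s.2.1 s.2.2.1 s.2.2.2.1 hv).1,
                (erase_spec α s.2.1 s.2.2.1 s.2.2.2.1 hv).2.1,
                (erase_spec α s.2.1 s.2.2.1 s.2.2.2.1 hv).2.2, h⟩⟩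

/-- Value of `φ` on a basis element, in component `x`. -/
noncomputable def phiC {α : Type u} [PartialOrder α] (D : Set α) (n : ℤ)
    (s : FChains α Set.univ Dᶜ n) (x : D) :
    FCgrp α {a | a ≤ (x : α) ∨ (x : α) ≤ a}
          ({a | a ≤ (x : α) ∨ (x : α) ≤ a} \ {(x : α)}) n :=
  if hx : (x : α) ∈ s.1 then
    Finsupp.single (toC s x hx) 1
  else 0

noncomputable def phiH {α : Type u} [PartialOrder α] [Fintype α] (D : Set α) (n : ℤ) :
    FCgrp α Set.univ Dᶜ n →+
        Π₀ x : D, FCgrp α {a | a ≤ (x : α) ∨ (x : α) ≤ a}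
          ({a | a ≤ (x : α) ∨ (x : α) ≤ a} \ {(x : α)}) n :=
  Finsupp.liftAddHom fun s =>
    zmultiplesHom _ (DFinsupp.equivFunOnFintype.symm (phiC D n s))

theorem phiH_single {α : Type u} [PartialOrder α] [Fintype α] (D : Set α) (n : ℤ)
    (s : FChains α Set.univ Dᶜ n) :
    phiH D n (Finsupp.single s 1) = DFinsupp.equivFunOnFintype.symm (phiC D n s) := by
  simp [phiH]

theorem iMap_single {α : Type u} [PartialOrder α] (D : Set α) (x : D) (n : ℤ)
    (s : FChains α {a | a ≤ (x : α) ∨ (x : α) ≤ a}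
        ({a | a ≤ (x : α) ∨ (x : α) ≤ a} \ {(x : α)}) n) (c : ℤ) :
    iMap D x n (Finsupp.single s c) = Finsupp.single (toX x s) c :=
  Finsupp.mapDomain_single

theorem psi_phi {α : Type u} [PartialOrder α] [Fintype α] (D : Set α)
    (hD : IsAntichain (· ≤ ·) D) (n : ℤ) :
    (DFinsupp.sumAddHom (fun x : D => iMap D x n)).comp (phiH D n) = AddMonoidHom.id _ := by
  refine Finsupp.addHom_ext' fun s => AddMonoidHom.ext_int ?_
  obtain ⟨x, hxs, hxD⟩ := Set.not_subset.mp s.2.2.2.2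
  have hxD' : x ∈ D := not_not.mp hxD
  have key : DFinsupp.equivFunOnFintype.symm (phiC D n s) =
      DFinsupp.single (⟨x, hxD'⟩ : D) (phiC D n s ⟨x, hxD'⟩) := by
    ext1 y
    by_cases h : (⟨x, hxD'⟩ : D) = y
    · subst h
      rw [DFinsupp.single_eq_same]
      rfl
    · have hy : (y : α) ∉ s.1 := fun hy =>
        h (Subtype.ext (aux_uniq hD s.2.2.1 hxD' y.2 hxs hy))
      rw [DFinsupp.single_eq_of_ne (Ne.symm h)]
      exact dif_neg hy
  simp only [AddMonoidHom.comp_apply, Finsupp.singleAddHom_apply, AddMonoidHom.id_apply]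
  rw [phiH_single, key, DFinsupp.sumAddHom_single, phiC, dif_pos (Finset.mem_coe.mp hxs),
    iMap_single]
  rfl

theorem phi_psi {α : Type u} [PartialOrder α] [Fintype α] (D : Set α)
    (hD : IsAntichain (· ≤ ·) D) (n : ℤ) :
    (phiH D n).comp (DFinsupp.sumAddHom (fun x : D => iMap D x n)) = AddMonoidHom.id _ := by
  refine DFinsupp.addHom_ext' fun x => Finsupp.addHom_ext' fun s => AddMonoidHom.ext_int ?_
  simp only [AddMonoidHom.comp_apply, Finsupp.singleAddHom_apply, AddMonoidHom.id_apply,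
    DFinsupp.singleAddHom_apply]
  rw [DFinsupp.sumAddHom_single, iMap_single, phiH_single]
  ext1 y
  by_cases h : x = y
  · subst h
    simp only [DFinsupp.single_eq_same]
    exact dif_pos (aux_mem s)
  · rw [DFinsupp.single_eq_of_ne (Ne.symm h)]
    exact dif_neg fun hy => h (Subtype.ext (aux_uniq hD s.2.2.1 x.2 y.2 (aux_mem s) hy))

theorem fd_single {α : Type u} [PartialOrder α] (S A : Set α) (n : ℤ) (s : FChains α S A n) :
    fd α S A n (Finsupp.single s 1) = ∑ v ∈ s.1.attach,
      chainSgn α s.1 v.1 •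
        (if h : ¬(↑(s.1.erase v.1) : Set α) ⊆ A then
          Finsupp.single (erC s v.1 v.2 h) (1 : ℤ)
         else 0) := by
  have := Finsupp.lift_apply (FCgrp α S A (n - 1)) ℤ (FChains α S A n)
    (fun s : FChains α S A n => ∑ v ∈ s.1.attach,
      chainSgn α s.1 v.1 •
        (if h : ¬(↑(s.1.erase v.1) : Set α) ⊆ A then
          Finsupp.single (erC s v.1 v.2 h) (1 : ℤ)
         else 0)) (Finsupp.single s (1 : ℤ))
  refine Eq.trans this ?_
  refine (Finsupp.sum_single_index ?_).trans (one_smul _ _)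
  exact zero_smul _ _

theorem iMap_comm {α : Type u} [PartialOrder α] (D : Set α)
    (hD : IsAntichain (· ≤ ·) D) (n : ℤ) (x : D) :
    (fd α Set.univ Dᶜ n).comp (iMap D x n) = (iMap D x (n - 1)).comp
      (fd α {a | a ≤ (x : α) ∨ (x : α) ≤ a}
              ({a | a ≤ (x : α) ∨ (x : α) ≤ a} \ {(x : α)}) n) := by
  refine Finsupp.addHom_ext' fun s => AddMonoidHom.ext_int ?_
  simp only [AddMonoidHom.comp_apply, Finsupp.singleAddHom_apply]
  rw [iMap_single, fd_single, fd_single, map_sum]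
  refine Finset.sum_congr rfl fun v _ => ?_
  rw [map_zsmul]
  congr 1
  have hxs := aux_mem s
  by_cases hv : v.1 = x
  · rw [dif_neg, dif_neg, map_zero]
    · rw [not_not]
      intro y hy
      rw [Finset.mem_coe, Finset.mem_erase] at hy
      exact ⟨s.2.1 hy.2, fun h => hy.1 (h.trans hv.symm)⟩
    · rw [not_not]
      intro y hy hyD
      have hy' := Finset.mem_erase.mp (Finset.mem_coe.mp hy)
      exact hy'.1 ((aux_uniq hD s.2.2.1 hyD x.2 hy'.2 hxs).trans hv.symm)
  · have hm : (x : α) ∈ s.1.erase v.1 := Finset.mem_erase.mpr ⟨Ne.symm hv, hxs⟩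
    rw [dif_pos, dif_pos, iMap_single]
    · rfl
    · exact fun h => (h (Finset.mem_coe.mpr hm)).2 rfl
    · exact fun h => h (Finset.mem_coe.mpr hm) x.2

theorem psi_comm {α : Type u} [PartialOrder α] (D : Set α)
    (hD : IsAntichain (· ≤ ·) D) (n : ℤ) :
    (fd α Set.univ Dᶜ n).comp (DFinsupp.sumAddHom (fun x : D => iMap D x n)) =
    (DFinsupp.sumAddHom (fun x : D => iMap D x (n - 1))).comp
      (DFinsupp.mapRange.addMonoidHom (fun x : D =>
            fd α {a | a ≤ (x : α) ∨ (x : α) ≤ a}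
              ({a | a ≤ (x : α) ∨ (x : α) ≤ a} \ {(x : α)}) n)) := by
  refine DFinsupp.addHom_ext fun x σ => ?_
  simp only [AddMonoidHom.comp_apply, DFinsupp.mapRange.addMonoidHom_apply]
  rw [DFinsupp.mapRange_single, DFinsupp.sumAddHom_single, DFinsupp.sumAddHom_single]
  exact DFunLike.congr_fun (iMap_comm D hD n x) σ

/-- Let `X` be a finite poset and `D ⊆ X` an antichain.  The map
`φ_n : C^f_n(X, X∖D) → ⊕_{x ∈ D} C^f_n(C_x, Ĉ_x)`, whose `x`-component sends the class of an
`n`-chain `s` to the class of `s` in `C^f_n(C_x, Ĉ_x)` if `x ∈ s` and to `0` otherwise, is a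
group isomorphism; its inverse sends `(σ_x)_x` to `∑_x i^x_n(σ_x)`, and these isomorphisms
commute with the differentials, so `C^f(X, X∖D) ≅ ⊕_{x ∈ D} C^f(C_x, Ĉ_x)` as chain
complexes. -/
theorem stmt1 {α : Type u} [PartialOrder α] [Fintype α] (D : Set α)
    (hD : IsAntichain (· ≤ ·) D) :
    ∃ φ : (n : ℤ) → (FCgrp α Set.univ Dᶜ n ≃+
        Π₀ x : D, FCgrp α {a | a ≤ (x : α) ∨ (x : α) ≤ a}
          ({a | a ≤ (x : α) ∨ (x : α) ≤ a} \ {(x : α)}) n),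
      (∀ (n : ℤ) (s : FChains α Set.univ Dᶜ n) (x : D),
        φ n (Finsupp.single s 1) x =
          if hx : (x : α) ∈ s.1 then
            Finsupp.single
              (⟨s.1, by
                  intro y hy
                  rcases eq_or_ne y (x : α) with h | h
                  · exact Or.inl (le_of_eq h)
                  · exact s.2.2.1 hy (Finset.mem_coe.mpr hx) h,
                s.2.2.1, s.2.2.2.1, by
                  intro hsub
                  exact (hsub (Finset.mem_coe.mpr hx)).2 rfl⟩ :
                FChains α {a | a ≤ (x : α) ∨ (x : α) ≤ a}
                  ({a | a ≤ (x : α) ∨ (x : α) ≤ a} \ {(x : α)}) n)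
              (1 : ℤ)
          else 0) ∧
      (∀ n : ℤ, (φ n).symm.toAddMonoidHom =
        DFinsupp.sumAddHom (fun x : D => iMap D x n)) ∧
      (∀ n : ℤ,
        (φ (n - 1)).toAddMonoidHom.comp (fd α Set.univ Dᶜ n) =
          (DFinsupp.mapRange.addMonoidHom (fun x : D =>
            fd α {a | a ≤ (x : α) ∨ (x : α) ≤ a}
              ({a | a ≤ (x : α) ∨ (x : α) ≤ a} \ {(x : α)}) n)).comp
            (φ n).toAddMonoidHom) := by
  refine ⟨fun n => AddMonoidHom.toAddEquiv (phiH D n)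
    (DFinsupp.sumAddHom (fun x : D => iMap D x n)) (psi_phi D hD n) (phi_psi D hD n),
    ?_, fun n => rfl, ?_⟩
  · intro n s x
    exact DFunLike.congr_fun (phiH_single D n s) x
  · intro n
    change (phiH D (n - 1)).comp _ = AddMonoidHom.comp _ (phiH D n)
    have h1 := congrArg (fun f => ((phiH D (n - 1)).comp f).comp (phiH D n)) (psi_comm D hD n)
    simp only [AddMonoidHom.comp_assoc, psi_phi D hD n, AddMonoidHom.comp_id] at h1
    rw [h1, ← AddMonoidHom.comp_assoc, phi_psi D hD (n - 1), AddMonoidHom.id_comp]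
end

section
/- Let X be a finite poset which is quasicellular with quasicellular morphism ρ, and let (a,b) be a homologically admissible edge of the Hasse diagram of X (so b covers a and Û_b ∖ {a} has trivial reduced f-homology in every degree). Then ρ(b) = ρ(a) + 1. -/
open scoped Classical

universe u

/-- `ρ` is a quasicellular morphism for the poset `α`: it is order preserving, its level sets
are antichains, and for every `x` the reduced f-homology of `Û_x = {a | a < x}` is zero in
every degree other than `ρ(x) - 1` and nonzero in degree `ρ(x) - 1`. -/
def IsQuasicellular (α : Type u) [PartialOrder α] (ρ : α → ℕ) : Prop :=
  Monotone ρ ∧ (∀ n : ℕ, IsAntichain (· ≤ ·) {x : α | ρ x = n}) ∧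
    ∀ x : α,
      (∀ k : ℤ, k ≠ (ρ x : ℤ) - 1 → Subsingleton (RH α {a | a < x} k)) ∧
        ¬Subsingleton (RH α {a | a < x} ((ρ x : ℤ) - 1))

section Aux

variable {α : Type u} [PartialOrder α]

theorem lift_single {M X : Type*} [AddCommGroup M] (f : X → M) (x : X) :
    (Finsupp.lift M ℤ X f) (Finsupp.single x 1) = f x := by
  rw [Finsupp.lift_apply, Finsupp.sum_single_index, one_smul]
  exact zero_smul _ _

noncomputable def gD : (Finset α →₀ ℤ) →ₗ[ℤ] (Finset α →₀ ℤ) :=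
  Finsupp.lift (Finset α →₀ ℤ) ℤ (Finset α) (fun s =>
    ∑ v ∈ s, chainSgn α s v • Finsupp.single (s.erase v) (1 : ℤ))

noncomputable def gQ (a : α) : (Finset α →₀ ℤ) →ₗ[ℤ] (Finset α →₀ ℤ) :=
  Finsupp.lift (Finset α →₀ ℤ) ℤ (Finset α) (fun s => Finsupp.single (insert a s) (1 : ℤ))

noncomputable def gP (a : α) : (Finset α →₀ ℤ) →ₗ[ℤ] (Finset α →₀ ℤ) :=
  Finsupp.lift (Finset α →₀ ℤ) ℤ (Finset α)
    (fun s => if a ∈ s then Finsupp.single (s.erase a) (1 : ℤ) else 0)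

noncomputable def gT : (Finset α →₀ ℤ) →ₗ[ℤ] (Finset α →₀ ℤ) :=
  Finsupp.lift (Finset α →₀ ℤ) ℤ (Finset α)
    (fun s => ((-1 : ℤ) ^ s.card) • Finsupp.single s (1 : ℤ))

theorem gD_single (s : Finset α) : gD (Finsupp.single s (1 : ℤ)) =
    ∑ v ∈ s, chainSgn α s v • Finsupp.single (s.erase v) (1 : ℤ) := by
  exact lift_single _ _

theorem gQ_single (a : α) (s : Finset α) : gQ a (Finsupp.single s (1 : ℤ)) =
    Finsupp.single (insert a s) (1 : ℤ) := by
  exact lift_single _ _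

theorem gP_single (a : α) (s : Finset α) : gP a (Finsupp.single s (1 : ℤ)) =
    if a ∈ s then Finsupp.single (s.erase a) (1 : ℤ) else 0 := by
  exact lift_single _ _

theorem gT_single (s : Finset α) : gT (Finsupp.single s (1 : ℤ)) =
    ((-1 : ℤ) ^ s.card) • Finsupp.single s (1 : ℤ) := by
  exact lift_single _ _

def PC (S : Set α) (n : ℤ) : Set (Finset α) :=
  {s | (↑s : Set α) ⊆ S ∧ IsChain (· ≤ ·) (↑s : Set α) ∧ (s.card : ℤ) = n + 1}

abbrev SC (S : Set α) (n : ℤ) : Submodule ℤ (Finset α →₀ ℤ) := Finsupp.supported ℤ ℤ (PC S n)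

/-- induction on supported. -/
theorem supp_ind {K : Set (Finset α)} {p : (Finset α →₀ ℤ) → Prop} (h0 : p 0)
    (hadd : ∀ x y, p x → p y → p (x + y)) (hsm : ∀ (c : ℤ) x, p x → p (c • x))
    (hs : ∀ s ∈ K, p (Finsupp.single s 1)) {x : Finset α →₀ ℤ}
    (hx : x ∈ Finsupp.supported ℤ ℤ K) : p x := by
  rw [Finsupp.supported_eq_span_single] at hx
  induction hx using Submodule.span_induction with
  | mem x h => obtain ⟨s, hs', rfl⟩ := h; exact hs s hs'
  | zero => exact h0
  | add x y _ _ hx hy => exact hadd x y hx hy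
  | smul c x _ hx => exact hsm c x hx

theorem single_mem {K : Set (Finset α)} {s : Finset α} (h : s ∈ K) :
    Finsupp.single s (1 : ℤ) ∈ Finsupp.supported ℤ ℤ K :=
  Finsupp.single_mem_supported ℤ 1 h

theorem map_supp {K L : Set (Finset α)} (f : (Finset α →₀ ℤ) →ₗ[ℤ] (Finset α →₀ ℤ))
    (h : ∀ s ∈ K, f (Finsupp.single s 1) ∈ Finsupp.supported ℤ ℤ L) {x : Finset α →₀ ℤ}
    (hx : x ∈ Finsupp.supported ℤ ℤ K) : f x ∈ Finsupp.supported ℤ ℤ L := by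
  refine supp_ind (p := fun x => f x ∈ Finsupp.supported ℤ ℤ L) ?_ ?_ ?_ h hx
  · simp
  · intro x y hx hy; rw [map_add]; exact Submodule.add_mem _ hx hy
  · intro c x hx; rw [map_smul]; exact Submodule.smul_mem _ _ hx

theorem map_eq {K : Set (Finset α)} (f g : (Finset α →₀ ℤ) →ₗ[ℤ] (Finset α →₀ ℤ))
    (h : ∀ s ∈ K, f (Finsupp.single s 1) = g (Finsupp.single s 1)) {x : Finset α →₀ ℤ}
    (hx : x ∈ Finsupp.supported ℤ ℤ K) : f x = g x := by
  refine supp_ind (p := fun x => f x = g x) ?_ ?_ ?_ h hx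
  · simp
  · intro x y hx hy; rw [map_add, map_add, hx, hy]
  · intro c x hx; rw [map_smul, map_smul, hx]

/-- T anticommutes with D -/
theorem gT_gD (x : Finset α →₀ ℤ) : gT (gD x) = - gD (gT x) := by
  have := map_eq (K := Set.univ) (gT ∘ₗ gD) (-(gD ∘ₗ gT)) (x := x) ?_ (by simp)
  · simpa using this
  · intro s _
    simp only [LinearMap.comp_apply, LinearMap.neg_apply, gD_single, gT_single, map_smul, map_sum]
    rw [Finset.smul_sum, ← Finset.sum_neg_distrib]
    refine Finset.sum_congr rfl fun v hv => ?_
    have hc : s.card = (s.erase v).card + 1 := (Finset.card_erase_add_one hv).symm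
    rw [hc, pow_succ, smul_comm]
    simp

theorem gD_gQ (a : α) {x : Finset α →₀ ℤ}
    (hx : x ∈ Finsupp.supported ℤ ℤ {s : Finset α | ∀ v ∈ s, v < a}) :
    gD (gQ a x) = gQ a (gD x) + gT x := by
  refine map_eq (gD ∘ₗ gQ a) (gQ a ∘ₗ gD + gT) ?_ hx
  intro s hs
  simp only [Set.mem_ofPred_eq] at hs
  have ha : a ∉ s := fun h => lt_irrefl _ (hs a h)
  simp only [LinearMap.comp_apply, LinearMap.add_apply, gD_single, gT_single, gQ_single, map_smul,
    map_sum]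
  rw [Finset.sum_insert ha, add_comm]
  congr 1
  · refine Finset.sum_congr rfl fun v hv => ?_
    have h1 : (insert a s).erase v = insert a (s.erase v) :=
      Finset.erase_insert_of_ne (fun h => ha (h ▸ hv))
    rw [h1]
    congr 1
    unfold chainSgn
    rw [Finset.filter_insert, if_neg (not_lt_of_gt (hs v hv))]
  · rw [Finset.erase_insert ha]
    congr 1
    unfold chainSgn
    rw [Finset.filter_insert, if_neg (lt_irrefl a), Finset.filter_true_of_mem hs]

theorem gP_gQ (a : α) {x : Finset α →₀ ℤ}
    (hx : x ∈ Finsupp.supported ℤ ℤ {s : Finset α | a ∉ s}) : gP a (gQ a x) = x := by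
  refine map_eq (gP a ∘ₗ gQ a) LinearMap.id ?_ hx
  intro s hs
  simp only [Set.mem_ofPred_eq] at hs
  simp [gQ_single, gP_single, hs]

theorem gP_zero (a : α) {x : Finset α →₀ ℤ}
    (hx : x ∈ Finsupp.supported ℤ ℤ {s : Finset α | a ∉ s}) : gP a x = 0 := by
  refine map_eq (gP a) 0 ?_ hx
  intro s hs
  simp only [Set.mem_ofPred_eq] at hs
  simp [gP_single, hs]

theorem gD_notMem (a : α) {x : Finset α →₀ ℤ}
    (hx : x ∈ Finsupp.supported ℤ ℤ {s : Finset α | a ∉ s}) :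
    gD x ∈ Finsupp.supported ℤ ℤ {s : Finset α | a ∉ s} := by
  refine map_supp gD ?_ hx
  intro s hs
  rw [gD_single]
  refine Submodule.sum_mem _ fun v _ => Submodule.smul_mem _ _ (single_mem ?_)
  exact fun h => hs (Finset.mem_of_mem_erase h)

theorem gT_mem {K : Set (Finset α)} {x : Finset α →₀ ℤ} (hx : x ∈ Finsupp.supported ℤ ℤ K) :
    gT x ∈ Finsupp.supported ℤ ℤ K := by
  refine map_supp gT (fun s hs => ?_) hx
  rw [gT_single]; exact Submodule.smul_mem _ _ (single_mem hs)

/-- Acyclicity in degree n, ungraded form. -/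
def Acyc (S : Set α) (n : ℤ) : Prop :=
  ∀ z ∈ SC S n, gD z = 0 → ∃ w ∈ SC S (n + 1), gD w = z

theorem core (a b : α) (hcov : a ⋖ b) (k : ℤ) (hA : Acyc ({y | y < b} \ {a}) k)
    (hU : Acyc {y | y < a} (k - 1)) : Acyc {y | y < b} k := by
  intro z hz hDz
  -- decomposition
  have hdec : ∃ x ∈ SC ({y | y < b} \ {a}) k, ∃ y ∈ SC {y | y < a} (k - 1), z = x + gQ a y := by
    refine supp_ind (K := PC {y | y < b} k) (p := fun z => ∃ x ∈ SC ({y | y < b} \ {a}) k,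
      ∃ y ∈ SC {y | y < a} (k - 1), z = x + gQ a y) ?_ ?_ ?_ ?_ hz
    · exact ⟨0, Submodule.zero_mem _, 0, Submodule.zero_mem _, by simp⟩
    · rintro _ _ ⟨x, hx, y, hy, rfl⟩ ⟨x', hx', y', hy', rfl⟩
      exact ⟨x + x', Submodule.add_mem _ hx hx', y + y', Submodule.add_mem _ hy hy', by
        rw [map_add]; abel⟩
    · rintro c _ ⟨x, hx, y, hy, rfl⟩
      exact ⟨c • x, Submodule.smul_mem _ _ hx, c • y, Submodule.smul_mem _ _ hy, by
        rw [map_smul, smul_add]⟩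
    · rintro s ⟨h1, h2, h3⟩
      by_cases ha : a ∈ s
      · refine ⟨0, Submodule.zero_mem _, Finsupp.single (s.erase a) 1, single_mem ⟨?_, ?_, ?_⟩, ?_⟩
        · intro v hv
          have hv' : v ≠ a ∧ v ∈ s := ⟨(Finset.mem_erase.1 hv).1, (Finset.mem_erase.1 hv).2⟩
          have hvb : v < b := h1 hv'.2
          rcases h2 hv'.2 ha hv'.1 with h | h
          · exact lt_of_le_of_ne h hv'.1
          · exact absurd hvb (hcov.2 (lt_of_le_of_ne h (Ne.symm hv'.1)))
        · exact h2.mono (by simp)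
        · rw [Finset.cast_card_erase_of_mem ha, h3]; ring
        · rw [gQ_single, Finset.insert_erase ha, zero_add]
      · refine ⟨Finsupp.single s 1, single_mem ⟨?_, h2, h3⟩, 0, Submodule.zero_mem _, by simp⟩
        intro v hv
        exact ⟨h1 hv, fun h => ha (by rw [← Set.mem_singleton_iff.1 h]; exact hv)⟩
  obtain ⟨x, hx, y, hy, rfl⟩ := hdec
  have hlt : ∀ n, SC {y | y < a} n ≤ Finsupp.supported ℤ ℤ {s : Finset α | ∀ v ∈ s, v < a} :=
    fun n => Finsupp.supported_mono fun s hs v hv => hs.1 hv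
  have hna : ∀ n, SC {y | y < a} n ≤ Finsupp.supported ℤ ℤ {s : Finset α | a ∉ s} :=
    fun n => Finsupp.supported_mono fun s hs hv => lt_irrefl a (hs.1 hv)
  have hnA : SC ({y | y < b} \ {a}) k ≤ Finsupp.supported ℤ ℤ {s : Finset α | a ∉ s} :=
    Finsupp.supported_mono fun s hs hv => (hs.1 hv).2 rfl
  rw [map_add, gD_gQ a (hlt _ hy)] at hDz
  have hDy : gD y = 0 := by
    have := congrArg (gP a) hDz
    rw [map_add, map_add, gP_zero a (gD_notMem a (hnA hx)), gP_gQ a (gD_notMem a (hna _ hy)),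
      gP_zero a (gT_mem (hna _ hy))] at this
    simpa using this
  obtain ⟨w, hw, rfl⟩ := hU y hy hDy
  have hk : k - 1 + 1 = k := by ring
  rw [hk] at hw
  have hwA : w ∈ SC ({y | y < b} \ {a}) k := by
    refine Finsupp.supported_mono (s := PC {y | y < a} k) ?_ hw
    rintro s hs
    refine ⟨fun v hv => ?_, hs.2⟩
    have : v < a := hs.1 hv
    exact ⟨this.trans hcov.1, this.ne⟩
  rw [hDy, map_zero, zero_add, gT_gD] at hDz
  obtain ⟨v, hv, hDv⟩ := hA (x - gT w) (Submodule.sub_mem _ hx (gT_mem hwA)) (by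
    rw [map_sub, sub_eq_add_neg]; exact hDz)
  refine ⟨gQ a w + v, Submodule.add_mem _ ?_ ?_, ?_⟩
  · refine map_supp (gQ a) (fun s hs => ?_) hw
    rw [gQ_single]
    have ha : a ∉ s := fun hv => lt_irrefl a (hs.1 hv)
    refine single_mem ⟨?_, ?_, ?_⟩
    · intro v hv
      rcases Finset.mem_insert.1 (Finset.mem_coe.1 hv) with rfl | h
      · exact hcov.1
      · exact lt_trans (hs.1 h) hcov.1
    · rw [Finset.coe_insert]
      exact hs.2.1.insert fun v hv _ => Or.inr (le_of_lt (hs.1 hv))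
    · rw [Finset.card_insert_of_notMem ha]; push_cast; rw [hs.2.2]
  · exact Finsupp.supported_mono (s := PC ({y | y < b} \ {a}) (k + 1))
      (t := PC {y | y < b} (k + 1)) (fun s hs => ⟨fun v hv => (hs.1 hv).1, hs.2⟩) hv
  · rw [map_add, gD_gQ a (hlt _ hw), hDv]; abel

/-- embedding in the ungraded group -/
noncomputable def gE (S : Set α) (n : ℤ) : RCgrp α S n →ₗ[ℤ] (Finset α →₀ ℤ) :=
  Finsupp.lmapDomain ℤ ℤ (fun s : RChains α S n => s.1)

theorem gE_inj (S : Set α) (n : ℤ) : Function.Injective (gE S n) :=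
  Finsupp.mapDomain_injective Subtype.val_injective

theorem gE_single (S : Set α) (n : ℤ) (s : RChains α S n) (c : ℤ) :
    gE S n (Finsupp.single s c) = Finsupp.single s.1 c := Finsupp.mapDomain_single

theorem gE_mem (S : Set α) (n : ℤ) (x : RCgrp α S n) : gE S n x ∈ SC S n := by
  induction x using Finsupp.induction_linear with
  | zero => simp
  | add x y hx hy => rw [map_add]; exact Submodule.add_mem _ hx hy
  | single s c => rw [gE_single]; exact Finsupp.single_mem_supported ℤ c s.2

theorem gE_surj (S : Set α) (n : ℤ) {z : Finset α →₀ ℤ} (hz : z ∈ SC S n) :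
    ∃ x, gE S n x = z := by
  refine supp_ind (K := PC S n) (p := fun z => ∃ x, gE S n x = z) ⟨0, by simp⟩ ?_ ?_ ?_ hz
  · rintro _ _ ⟨x, rfl⟩ ⟨y, rfl⟩; exact ⟨x + y, map_add _ _ _⟩
  · rintro c _ ⟨x, rfl⟩; exact ⟨c • x, map_smul _ _ _⟩
  · intro s hs; exact ⟨Finsupp.single (⟨s, hs⟩ : RChains α S n) 1, gE_single _ _ _ _⟩

theorem gE_rd (S : Set α) (n : ℤ) (x : RCgrp α S n) :
    gE S (n - 1) (rd α S n x) = gD (gE S n x) := by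
  induction x using Finsupp.induction_linear with
  | zero => simp
  | add x y hx hy => rw [map_add, map_add, map_add, map_add, hx, hy]
  | single s c =>
    have hc : (Finsupp.single s c : RCgrp α S n) = c • Finsupp.single s (1 : ℤ) := by simp
    rw [hc, map_zsmul, map_zsmul, map_zsmul, map_zsmul, gE_single, gD_single]
    congr 1
    have : rd α S n (Finsupp.single s (1 : ℤ)) = ∑ v ∈ s.1.attach,
      chainSgn α s.1 v.1 •
        Finsupp.single
          (⟨s.1.erase v.1, erase_spec α s.2.1 s.2.2.1 s.2.2.2 v.2⟩ : RChains α S (n - 1))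
          (1 : ℤ) := by
      exact lift_single _ _
    rw [this]
    refine (map_sum (gE S (n - 1)) _ _).trans ?_
    refine Eq.trans ?_ (Finset.sum_attach s.1
      (fun v => chainSgn α s.1 v • Finsupp.single (s.1.erase v) (1 : ℤ)))
    refine Finset.sum_congr rfl fun v _ => ?_
    refine (map_zsmul (gE S (n - 1)) _ _).trans ?_
    exact congrArg (fun t => chainSgn α s.1 v.1 • t) (gE_single S (n - 1) _ 1)

theorem gE_cast (S : Set α) {m n : ℤ} (h : m = n) (x : RCgrp α S m) :
    gE S n (castAddEquiv (RCgrp α S) h x) = gE S m x := by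
  subst h; rfl

theorem acyc_iff (S : Set α) (n : ℤ) : Subsingleton (RH α S n) ↔ Acyc S n := by
  unfold RH gradedHomology
  rw [QuotientAddGroup.subsingleton_iff, AddSubgroup.addSubgroupOf_eq_top]
  constructor
  · intro h z hz hDz
    obtain ⟨x, rfl⟩ := gE_surj S n hz
    have hx : x ∈ (rd α S n).ker := by
      rw [AddMonoidHom.mem_ker]
      apply gE_inj
      rw [gE_rd, hDz, map_zero]
    obtain ⟨_, ⟨w, rfl⟩, hw⟩ := h hx
    refine ⟨gE S (n + 1) w, gE_mem _ _ _, ?_⟩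
    rw [← gE_rd, ← hw]
    exact (gE_cast S _ _).symm
  · intro h x hx
    rw [AddMonoidHom.mem_ker] at hx
    obtain ⟨w, hw, hDw⟩ := h (gE S n x) (gE_mem _ _ _) (by rw [← gE_rd, hx, map_zero])
    obtain ⟨w, rfl⟩ := gE_surj S _ hw
    refine ⟨_, ⟨w, rfl⟩, ?_⟩
    apply gE_inj
    rw [← hDw, ← gE_rd]
    exact gE_cast S _ _

end Aux

theorem stmt5 {α : Type u} [PartialOrder α] [Fintype α] (ρ : α → ℕ)
    (hρ : IsQuasicellular α ρ) (a b : α) (hcov : a ⋖ b)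
    (hadm : ∀ k : ℤ, Subsingleton (RH α ({y | y < b} \ {a}) k)) :
    ρ b = ρ a + 1 := by
  by_contra hne
  refine (hρ.2.2 b).2 ((acyc_iff _ _).2 (core a b hcov _ ((acyc_iff _ _).1 (hadm _))
    ((acyc_iff _ _).1 ((hρ.2.2 a).1 _ ?_))))
  omega
end
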